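/- Let K be a type with decidable equality, V a type, v₀ : K → V, U a finite set with endT : U → ℕ injective and writes w : U → K → Option V, and define stateAt s := List.foldl (fun g u => fun k => (w u k).getD (g k)) v₀ L_s, where L_s is the list of elements of {u ∈ U | endT u ≤ s} sorted in strictly increasing order of endT. Then for all s, s' : ℕ with s ≤ s' and every k : K, if w u k = none for every u ∈ U with s < endT u ≤ s', then stateAt s k = stateAt s' k. -/

import Mathlib

/-- Folding register updates over a list of transactions none of which writes to `k`
leaves the value of `k` unchanged. -/
theorem foldl_getD_apply_of_forall_eq_none {K V U : Type*} (w : U → K → Option V) (k : K)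
    (l : List U) (h : ∀ u ∈ l, w u k = none) (g : K → V) :
    (List.foldl (fun g u => fun k' => (w u k').getD (g k')) g l) k = g k := by
  induction l generalizing g with
  | nil => rfl
  | cons a l ih =>
    rw [List.foldl_cons, ih (fun u hu => h u (List.mem_cons_of_mem a hu))]
    simp [h a List.mem_cons_self]

/-- Two lists with the same elements, both strictly increasing along `f`, are equal. -/
theorem List.eq_of_pairwise_lt_of_mem_iff {U α : Type*} [Preorder α] (f : U → α)
    {l l' : List U} (hl : l.Pairwise fun a b => f a < f b)
    (hl' : l'.Pairwise fun a b => f a < f b) (h : ∀ u, u ∈ l ↔ u ∈ l') : l = l' := by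
  have nodup {m : List U} (hm : m.Pairwise fun a b => f a < f b) : m.Nodup :=
    hm.imp fun hab => ne_of_apply_ne f hab.ne
  exact List.Perm.eq_of_pairwise (fun a b _ _ hab hba => (lt_asymm hab hba).elim) hl hl'
    ((List.perm_ext_iff_of_nodup (nodup hl) (nodup hl')).2 h)

/-- Snapshot invariance: if no committed updating transaction with end timestamp
in `(s, s']` writes to register `k`, then the value of `k` in the replicated
state is the same at logical times `s` and `s'`. -/
theorem stateAt_eq_of_no_writes {K : Type*} [DecidableEq K] {V : Type*}
    (v₀ : K → V) {U : Type*} [Fintype U]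
    (endT : U → ℕ) (hinj : Function.Injective endT)
    (w : U → K → Option V) (s s' : ℕ) (hss : s ≤ s')
    (Ls Ls' : List U)
    (hmem : ∀ u, u ∈ Ls ↔ endT u ≤ s)
    (hsorted : Ls.Pairwise fun a b => endT a < endT b)
    (hmem' : ∀ u, u ∈ Ls' ↔ endT u ≤ s')
    (hsorted' : Ls'.Pairwise fun a b => endT a < endT b)
    (k : K)
    (hnone : ∀ u, s < endT u → endT u ≤ s' → w u k = none) :
    (List.foldl (fun g u => fun k' => (w u k').getD (g k')) v₀ Ls) k =
      (List.foldl (fun g u => fun k' => (w u k').getD (g k')) v₀ Ls') k := by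
  have hsplit : Ls' = Ls ++ Ls'.filter (fun u => s < endT u) := by
    refine List.eq_of_pairwise_lt_of_mem_iff endT hsorted'
      (List.pairwise_append.2 ⟨hsorted, hsorted'.filter _, fun a ha b hb => ?_⟩) fun u => ?_
    · have hb' := (List.mem_filter.1 hb).2
      exact ((hmem a).1 ha).trans_lt (of_decide_eq_true hb')
    · simp only [List.mem_append, List.mem_filter, hmem, hmem', decide_eq_true_eq]
      omega
  rw [hsplit, List.foldl_append]
  refine (foldl_getD_apply_of_forall_eq_none w k _ ?_ _).symm
  intro u hu
  simp only [List.mem_filter, hmem', decide_eq_true_eq] at hu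
  exact hnone u hu.2 hu.1
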